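/- Fix an integer e ≥ 2 and κ = (κ₁, κ₂) ∈ (ℤ/eℤ)². If λ is a bipartition with wt(λ) = 0, then for every i ∈ ℤ/eℤ, λ does not have both an addable i-node and a removable i-node. -/

import Mathlib

namespace Wt3

/-- `f : ℕ → ℕ` (0-indexed: `f r` is the `(r+1)`-th part `λ_{r+1}`) is a partition if it is
weakly decreasing with finitely many nonzero terms. -/
def IsPartition (f : ℕ → ℕ) : Prop :=
  (∀ r, f (r + 1) ≤ f r) ∧ ∃ N, ∀ r, N ≤ r → f r = 0

/-- A bipartition: an ordered pair of partitions, given as `lam : Fin 2 → ℕ → ℕ`. -/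
def IsBipartition (lam : Fin 2 → ℕ → ℕ) : Prop := ∀ a, IsPartition (lam a)

/-- Nodes `(r, c, a)` with 0-indexed row `r`, column `c`, and component `a : Fin 2`. -/
abbrev Node := ℕ × ℕ × Fin 2

/-- The Young diagram of a bipartition: `(r,c,a)` is a node iff `c < λ⁽ᵃ⁾_r` (0-indexed,
corresponding to `c+1 ≤ λ⁽ᵃ⁾_{r+1}` in 1-indexed terms). -/
def Diagram (lam : Fin 2 → ℕ → ℕ) : Set Node := {x | x.2.1 < lam x.2.2 x.1}

/-- A node of `[λ]` is removable if deleting it leaves the Young diagram of a bipartition. -/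
def IsRemovable (lam : Fin 2 → ℕ → ℕ) (x : Node) : Prop :=
  x ∈ Diagram lam ∧ ∃ mu, IsBipartition mu ∧ Diagram mu = Diagram lam \ {x}

/-- A node not in `[λ]` is addable if adding it gives the Young diagram of a bipartition. -/
def IsAddable (lam : Fin 2 → ℕ → ℕ) (x : Node) : Prop :=
  x ∉ Diagram lam ∧ ∃ mu, IsBipartition mu ∧ Diagram mu = Diagram lam ∪ {x}

/-- The residue `c − r + κ_a ∈ ℤ/eℤ` of a node `(r,c,a)` (0-indexing leaves this unchanged). -/
def res (e : ℕ) (κ : Fin 2 → ZMod e) (x : Node) : ZMod e :=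
  (x.2.1 : ZMod e) - (x.1 : ZMod e) + κ x.2.2

/-- `c_i(λ)`: the number of `i`-nodes of `λ`. -/
noncomputable def cnt (e : ℕ) (κ : Fin 2 → ZMod e) (lam : Fin 2 → ℕ → ℕ) (i : ZMod e) : ℕ :=
  Set.ncard {x : Node | x ∈ Diagram lam ∧ res e κ x = i}

/-- The number of removable `i`-nodes of `λ`. -/
noncomputable def remCount (e : ℕ) (κ : Fin 2 → ZMod e) (lam : Fin 2 → ℕ → ℕ) (i : ZMod e) : ℕ :=
  Set.ncard {x : Node | IsRemovable lam x ∧ res e κ x = i}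

/-- The number of addable `i`-nodes of `λ`. -/
noncomputable def addCount (e : ℕ) (κ : Fin 2 → ZMod e) (lam : Fin 2 → ℕ → ℕ) (i : ZMod e) : ℕ :=
  Set.ncard {x : Node | IsAddable lam x ∧ res e κ x = i}

/-- `δ_i(λ)`: number of removable `i`-nodes minus number of addable `i`-nodes. -/
noncomputable def delta (e : ℕ) (κ : Fin 2 → ZMod e) (lam : Fin 2 → ℕ → ℕ) (i : ZMod e) : ℤ :=
  (remCount e κ lam i : ℤ) - (addCount e κ lam i : ℤ)

/-- The weight `wt(λ) = c_{κ₁}(λ) + c_{κ₂}(λ) − ½ Σ_{i ∈ ℤ/eℤ} (c_i(λ) − c_{i+1}(λ))²`. -/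
noncomputable def wt (e : ℕ) (κ : Fin 2 → ZMod e) (lam : Fin 2 → ℕ → ℕ) : ℚ :=
  (cnt e κ lam (κ 0) : ℚ) + (cnt e κ lam (κ 1) : ℚ) -
    (1 / 2) * ∑ j ∈ Finset.range e,
      ((cnt e κ lam (j : ZMod e) : ℚ) - (cnt e κ lam ((j : ZMod e) + 1) : ℚ)) ^ 2

/-- The rim of `λ`: nodes `(r,c,a) ∈ [λ]` with `(r+1,c+1,a) ∉ [λ]`. -/
def Rim (lam : Fin 2 → ℕ → ℕ) : Set Node :=
  {x | x ∈ Diagram lam ∧ (x.1 + 1, x.2.1 + 1, x.2.2) ∉ Diagram lam}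

/-- One step along a strip: `y` is one step to the right of, or one step above, `x`
(in the same component). -/
def Step (x y : Node) : Prop :=
  y.2.2 = x.2.2 ∧ ((y.1 = x.1 ∧ y.2.1 = x.2.1 + 1) ∨ (x.1 = y.1 + 1 ∧ y.2.1 = x.2.1))

/-- A rim hook of `λ`: a nonempty subset of the rim, contained in a single component,
forming a connected strip, whose removal leaves the Young diagram of a bipartition. -/
def IsRimHook (lam : Fin 2 → ℕ → ℕ) (H : Finset Node) : Prop :=
  H.Nonempty ∧ ↑H ⊆ Rim lam ∧ (∀ x ∈ H, ∀ y ∈ H, x.2.2 = y.2.2) ∧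
    (∃ l : List Node, l.Chain' Step ∧ ∀ x : Node, x ∈ l ↔ x ∈ H) ∧
    ∃ mu, IsBipartition mu ∧ Diagram mu = Diagram lam \ ↑H

/-- A bicore: a bipartition with no rim `e`-hooks. -/
def IsBicore (e : ℕ) (lam : Fin 2 → ℕ → ℕ) : Prop :=
  ¬ ∃ H : Finset Node, IsRimHook lam H ∧ H.card = e

/-- The beta-set `{λ_r + k − r : 1 ≤ r ≤ k}` of a partition with charge `k` (0-indexed form). -/
def betaSet (f : ℕ → ℕ) (k : ℕ) : Finset ℕ :=
  (Finset.range k).image fun r => f r + (k - (r + 1))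

/-- The number of nonzero parts of a partition. -/
noncomputable def len (f : ℕ → ℕ) : ℕ := Set.ncard {r : ℕ | f r ≠ 0}

/-- `(k₁,k₂)` is a bicharge for `κ` relative to `λ`. -/
def IsBicharge (e : ℕ) (κ : Fin 2 → ZMod e) (lam : Fin 2 → ℕ → ℕ) (k₁ k₂ : ℕ) : Prop :=
  (k₁ : ZMod e) = κ 0 ∧ (k₂ : ZMod e) = κ 1 ∧ len (lam 0) ≤ k₁ ∧ len (lam 1) ≤ k₂

/-- `γ_x(λ)`: beads of residue `x` in the first beta-set minus those in the second. -/
def gamma (e : ℕ) (lam : Fin 2 → ℕ → ℕ) (k₁ k₂ : ℕ) (x : ZMod e) : ℤ :=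
  (((betaSet (lam 0) k₁).filter fun b : ℕ => (b : ZMod e) = x).card : ℤ) -
    (((betaSet (lam 1) k₂).filter fun b : ℕ => (b : ZMod e) = x).card : ℤ)

/-- `x` is above (higher than) `y`. -/
def Above (x y : Node) : Prop := x.2.2 < y.2.2 ∨ (x.2.2 = y.2.2 ∧ x.1 < y.1)

/-- A normal `i`-node: a removable `i`-node `x` such that for every addable `i`-node `y`
below `x`, the removable `i`-nodes strictly between `x` and `y` outnumber the addable ones
(equivalently, the `−` sign of `x` survives in the reduced `i`-signature). -/
def IsNormal (e : ℕ) (κ : Fin 2 → ZMod e) (lam : Fin 2 → ℕ → ℕ) (i : ZMod e) (x : Node) :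
    Prop :=
  IsRemovable lam x ∧ res e κ x = i ∧
    ∀ y : Node, IsAddable lam y → res e κ y = i → Above x y →
      Set.ncard {z : Node | IsAddable lam z ∧ res e κ z = i ∧ Above x z ∧ Above z y} <
        Set.ncard {z : Node | IsRemovable lam z ∧ res e κ z = i ∧ Above x z ∧ Above z y}

/-- The good `i`-node: the highest normal `i`-node. -/
def IsGood (e : ℕ) (κ : Fin 2 → ZMod e) (lam : Fin 2 → ℕ → ℕ) (i : ZMod e) (x : Node) :
    Prop :=
  IsNormal e κ lam i x ∧ ∀ y, IsNormal e κ lam i y → y = x ∨ Above x y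

/-- An antinormal `i`-node: a removable `i`-node `x` such that for every addable `i`-node `y`
above `x`, the removable `i`-nodes strictly between `y` and `x` outnumber the addable ones
(equivalently, the `−` sign of `x` survives in the antireduced `i`-signature). -/
def IsAntinormal (e : ℕ) (κ : Fin 2 → ZMod e) (lam : Fin 2 → ℕ → ℕ) (i : ZMod e) (x : Node) :
    Prop :=
  IsRemovable lam x ∧ res e κ x = i ∧
    ∀ y : Node, IsAddable lam y → res e κ y = i → Above y x →
      Set.ncard {z : Node | IsAddable lam z ∧ res e κ z = i ∧ Above y z ∧ Above z x} <
        Set.ncard {z : Node | IsRemovable lam z ∧ res e κ z = i ∧ Above y z ∧ Above z x}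

/-- The antigood `i`-node: the lowest antinormal `i`-node. -/
def IsAntigood (e : ℕ) (κ : Fin 2 → ZMod e) (lam : Fin 2 → ℕ → ℕ) (i : ZMod e) (x : Node) :
    Prop :=
  IsAntinormal e κ lam i x ∧ ∀ y, IsAntinormal e κ lam i y → y = x ∨ Above y x

/-- `μ →ᵢ λ`: `μ` is obtained from `λ` by removing the good `i`-node. -/
def RemGoodAt (e : ℕ) (κ : Fin 2 → ZMod e) (i : ZMod e) (mu lam : Fin 2 → ℕ → ℕ) : Prop :=
  ∃ x, IsGood e κ lam i x ∧ Diagram mu = Diagram lam \ {x}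

/-- `μ ⇒ᵢ λ`: `μ` is obtained from `λ` by removing the antigood `i`-node. -/
def RemAntigoodAt (e : ℕ) (κ : Fin 2 → ZMod e) (i : ZMod e) (mu lam : Fin 2 → ℕ → ℕ) : Prop :=
  ∃ x, IsAntigood e κ lam i x ∧ Diagram mu = Diagram lam \ {x}

/-- `μ → λ`: `μ` is obtained from the bipartition `λ` by removing a good node. -/
def RemGood (e : ℕ) (κ : Fin 2 → ZMod e) (mu lam : Fin 2 → ℕ → ℕ) : Prop :=
  IsBipartition mu ∧ IsBipartition lam ∧ ∃ i, RemGoodAt e κ i mu lam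

/-- A bipartition is restricted if it lies in the class of the empty bipartition under the
equivalence relation generated by `→`. -/
def IsRestricted (e : ℕ) (κ : Fin 2 → ZMod e) (lam : Fin 2 → ℕ → ℕ) : Prop :=
  Relation.EqvGen (RemGood e κ) lam (fun _ _ => 0)

/-- A partition is `e`-restricted if `λ_r − λ_{r+1} < e` for all `r`. -/
def IsERestricted (e : ℕ) (f : ℕ → ℕ) : Prop := ∀ r, f r < f (r + 1) + e

/-- The conjugate partition: `λ′_r = #{c : λ_c ≥ r}` (0-indexed form). -/
noncomputable def conjP (f : ℕ → ℕ) : ℕ → ℕ := fun r => Set.ncard {c : ℕ | r + 1 ≤ f c}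

/-- The conjugate bipartition `λ′ = ((λ⁽²⁾)′ | (λ⁽¹⁾)′)`. -/
noncomputable def conjB (lam : Fin 2 → ℕ → ℕ) : Fin 2 → ℕ → ℕ := fun a => conjP (lam (1 - a))

/-- `|λ|` for a partition. -/
noncomputable def psize (f : ℕ → ℕ) : ℕ := Set.ncard {p : ℕ × ℕ | p.2 < f p.1}

/-- `|λ|` for a bipartition. -/
noncomputable def bsize (lam : Fin 2 → ℕ → ℕ) : ℕ := psize (lam 0) + psize (lam 1)

/-- `λ_1 + ⋯ + λ_r`. -/
def psum (f : ℕ → ℕ) (r : ℕ) : ℕ := ∑ j ∈ Finset.range r, f j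

/-- The dominance order on bipartitions: `λ ⊵ μ`. -/
def Dominates (lam mu : Fin 2 → ℕ → ℕ) : Prop :=
  ∀ r : ℕ, psum (mu 0) r ≤ psum (lam 0) r ∧
    psize (mu 0) + psum (mu 1) r ≤ psize (lam 0) + psum (lam 1) r

/-! Single-partition versions (for statement 11). -/

abbrev Node1 := ℕ × ℕ

def Diagram1 (f : ℕ → ℕ) : Set Node1 := {x | x.2 < f x.1}

def IsRemovable1 (f : ℕ → ℕ) (x : Node1) : Prop :=
  x ∈ Diagram1 f ∧ ∃ g, IsPartition g ∧ Diagram1 g = Diagram1 f \ {x}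

def IsAddable1 (f : ℕ → ℕ) (x : Node1) : Prop :=
  x ∉ Diagram1 f ∧ ∃ g, IsPartition g ∧ Diagram1 g = Diagram1 f ∪ {x}

def res1 (e : ℕ) (k : ZMod e) (x : Node1) : ZMod e := (x.2 : ZMod e) - (x.1 : ZMod e) + k

def Rim1 (f : ℕ → ℕ) : Set Node1 := {x | x ∈ Diagram1 f ∧ (x.1 + 1, x.2 + 1) ∉ Diagram1 f}

def Step1 (x y : Node1) : Prop :=
  (y.1 = x.1 ∧ y.2 = x.2 + 1) ∨ (x.1 = y.1 + 1 ∧ y.2 = x.2)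

def IsRimHook1 (f : ℕ → ℕ) (H : Finset Node1) : Prop :=
  H.Nonempty ∧ ↑H ⊆ Rim1 f ∧
    (∃ l : List Node1, l.Chain' Step1 ∧ ∀ x : Node1, x ∈ l ↔ x ∈ H) ∧
    ∃ g, IsPartition g ∧ Diagram1 g = Diagram1 f \ ↑H

/-- An `e`-core: a partition with no rim `e`-hooks. -/
def IsECore (e : ℕ) (f : ℕ → ℕ) : Prop := ¬ ∃ H : Finset Node1, IsRimHook1 f H ∧ H.card = e

/-! The statement. -/

/-- The number of nodes of residue `i` in a row of length `m` whose leftmost node has residue `k`. -/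
def rowCount {e : ℕ} (m : ℕ) (k i : ZMod e) : ℤ :=
  ∑ t ∈ Finset.range m, if (t : ZMod e) + k = i then 1 else 0

/-- The number of nodes of residue `i` in the first `N` rows of `f`, with charge `k`. -/
def rowsCount {e : ℕ} (f : ℕ → ℕ) (N : ℕ) (k i : ZMod e) : ℤ :=
  ∑ r ∈ Finset.range N, rowCount (f r) (k - (r : ZMod e)) i

lemma rowCount_sub_rowCount_add_one {e : ℕ} (m : ℕ) (k i : ZMod e) :
    rowCount m k i - rowCount m k (i + 1) =
      (if k + m - 1 = i then 1 else 0) - (if k - 1 = i then 1 else 0) := by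
  induction m with
  | zero => simp [rowCount]
  | succ m ih =>
    have h₁ : (m : ZMod e) + k = i + 1 ↔ k + m - 1 = i := by
      rw [sub_eq_iff_eq_add, add_comm k]
    have h₂ : (m : ZMod e) + k = i ↔ k + ((m + 1 : ℕ) : ZMod e) - 1 = i := by
      rw [Nat.cast_add, Nat.cast_one, ← add_assoc, add_sub_cancel_right, add_comm k]
    simp only [rowCount, Finset.sum_range_succ, h₁, h₂] at ih ⊢
    linarith

lemma rowCount_self {e : ℕ} (m : ℕ) (k : ZMod e) :
    rowCount m k k + (if (m : ZMod e) = 0 then 1 else 0) = 1 + rowCount m 1 (0 : ZMod e) := by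
  induction m with
  | zero => simp [rowCount]
  | succ m ih =>
    simp only [rowCount, Finset.sum_range_succ, add_eq_right, Nat.cast_add, Nat.cast_one] at ih ⊢
    linarith

lemma rowsCount_sub_rowsCount_add_one {e : ℕ} (f : ℕ → ℕ) (N : ℕ) (k i : ZMod e) :
    rowsCount f N k i - rowsCount f N k (i + 1) =
      (∑ r ∈ Finset.range N, if k - r + f r - 1 = i then 1 else 0) -
        ∑ r ∈ Finset.range N, if k - r - 1 = i then 1 else 0 := by
  simp only [rowsCount, ← Finset.sum_sub_distrib, rowCount_sub_rowCount_add_one]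

lemma rowsCount_succ {e : ℕ} (f : ℕ → ℕ) (N : ℕ) (k i : ZMod e) :
    rowsCount f (N + 1) k i =
      rowsCount (fun r => f (r + 1)) N (k - 1) i + rowCount (f 0) k i := by
  simp [rowsCount, Finset.sum_range_succ', sub_sub, add_comm]

/-- Counting the positions on the runner of the first bead of an abacus display which lie below
that bead. -/
lemma tail_rowsCount_sub_le {e : ℕ} {f : ℕ → ℕ} (hf : Antitone f) (N : ℕ) (k : ZMod e) :
    rowsCount (fun r => f (r + 1)) N (k - 1) (k + (f 0 : ZMod e) - 1) -
      rowsCount (fun r => f (r + 1)) N (k - 1) (k + (f 0 : ZMod e) - 1 + 1) ≤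
        rowCount (f 0) 1 (0 : ZMod e) := by
  rw [rowsCount_sub_rowsCount_add_one, sub_le_iff_le_add]
  have hle : ∀ r, f (r + 1) ≤ f 0 := fun r => hf (Nat.zero_le _)
  have h₁ : (∑ r ∈ Finset.range N,
        if k - 1 - (r : ZMod e) + (f (r + 1) : ZMod e) - 1 = k + f 0 - 1 then (1 : ℤ) else 0) =
      ∑ t ∈ (Finset.range N).image (fun r => r + (f 0 - f (r + 1))),
        if (t : ZMod e) + 1 = 0 then 1 else 0 := by
    rw [Finset.sum_image]
    · refine Finset.sum_congr rfl fun r _ => if_congr ?_ rfl rfl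
      push_cast [Nat.cast_sub (hle r)]
      constructor <;> intro h <;> linear_combination -h
    · intro a _ b _ hab
      have := hle a
      have := hle b
      simp only at hab
      rcases lt_trichotomy a b with h | h | h
      · have := hf (show a + 1 ≤ b + 1 by omega)
        omega
      · exact h
      · have := hf (show b + 1 ≤ a + 1 by omega)
        omega
  have h₂ : rowCount (f 0) 1 (0 : ZMod e) +
      (∑ r ∈ Finset.range N, if k - 1 - (r : ZMod e) - 1 = k + f 0 - 1 then (1 : ℤ) else 0) =
      ∑ t ∈ Finset.range (f 0 + N), if (t : ZMod e) + 1 = 0 then 1 else 0 := by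
    rw [Finset.sum_range_add, rowCount]
    congr 1
    refine Finset.sum_congr rfl fun r _ => if_congr ?_ rfl rfl
    push_cast
    constructor <;> intro h <;> linear_combination -h
  rw [h₁, h₂]
  refine Finset.sum_le_sum_of_subset_of_nonneg ?_ fun t _ _ => by split_ifs <;> simp
  intro t ht
  obtain ⟨r, hr, rfl⟩ := Finset.mem_image.1 ht
  have := Finset.mem_range.1 hr
  exact Finset.mem_range.2 (by omega)

lemma sum_sq_add_indicator_sub {ι : Type*} [Fintype ι] [DecidableEq ι] (d : ι → ℤ) (a b : ι) :
    ∑ j, (d j + ((if a = j then 1 else 0) - (if b = j then 1 else 0))) ^ 2 =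
      ∑ j, d j ^ 2 + 2 * d a - 2 * d b + 2 - 2 * (if a = b then 1 else 0) := by
  have h : ∀ j, (d j + ((if a = j then 1 else 0) - (if b = j then 1 else 0))) ^ 2 =
      d j ^ 2 + (if a = j then 2 * d j + 1 - 2 * (if a = b then 1 else 0) else 0) +
        (if b = j then 1 - 2 * d j else 0) := by
    intro j
    by_cases ha : a = j <;> by_cases hb : b = j <;> simp [ha, hb] <;> grind
  simp only [h, Finset.sum_add_distrib, Finset.sum_ite_eq, Finset.mem_univ, if_true]
  ring

/-- The `e`-weight of a partition is non-negative. -/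
lemma sum_sq_le_two_mul_rowsCount {e : ℕ} [NeZero e] (N : ℕ) (f : ℕ → ℕ) (hf : Antitone f)
    (k : ZMod e) :
    ∑ j, (rowsCount f N k j - rowsCount f N k (j + 1)) ^ 2 ≤ 2 * rowsCount f N k k := by
  induction N generalizing f k with
  | zero => simp [rowsCount]
  | succ N ih =>
    have ih' := ih (fun r => f (r + 1)) (fun a b h => hf (Nat.succ_le_succ h)) (k - 1)
    have hd := tail_rowsCount_sub_le hf N k
    have hs := rowCount_self (f 0) k
    have h : ∀ j, rowsCount f (N + 1) k j - rowsCount f (N + 1) k (j + 1) =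
        (rowsCount (fun r => f (r + 1)) N (k - 1) j -
          rowsCount (fun r => f (r + 1)) N (k - 1) (j + 1)) +
        ((if k + f 0 - 1 = j then 1 else 0) - (if k - 1 = j then 1 else 0)) := by
      intro j
      rw [← rowCount_sub_rowCount_add_one, rowsCount_succ, rowsCount_succ]
      ring
    simp only [h]
    rw [sum_sq_add_indicator_sub (fun j => rowsCount (fun r => f (r + 1)) N (k - 1) j -
          rowsCount (fun r => f (r + 1)) N (k - 1) (j + 1)), rowsCount_succ f N k k]
    have hab : k + (f 0 : ZMod e) - 1 = k - 1 ↔ (f 0 : ZMod e) = 0 := by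
      rw [sub_left_inj, add_eq_left]
    simp only [hab, sub_add_cancel] at hd ⊢
    linarith

lemma sum_range_natCast_zmod {e : ℕ} [NeZero e] {M : Type*} [AddCommMonoid M] (F : ZMod e → M) :
    ∑ j ∈ Finset.range e, F (j : ZMod e) = ∑ x, F x :=
  Finset.sum_nbij' (fun j => (j : ZMod e)) ZMod.val (by simp)
    (fun x _ => Finset.mem_range.2 x.val_lt)
    (fun j hj => ZMod.val_cast_of_lt (Finset.mem_range.1 hj)) (by simp) (by simp)

/-- A closed walk of integer heights with `e` steps passing through the heights `u a` and `u b`. -/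
lemma two_mul_sub_le_sum_sq {e : ℕ} [NeZero e] (u : ZMod e → ℤ) (a b : ZMod e) :
    2 * (u a - u b) ≤ ∑ j, (u j - u (j + 1)) ^ 2 := by
  set v : ℕ → ℤ := fun t => u (a + t) with hv
  set L := (b - a).val with hL
  have hLe : L ≤ e := (ZMod.val_lt _).le
  have hsum : ∑ j, (u j - u (j + 1)) ^ 2 = ∑ t ∈ Finset.range e, (v t - v (t + 1)) ^ 2 := by
    rw [← Equiv.sum_comp (Equiv.addLeft a), ← sum_range_natCast_zmod]
    simp [hv, add_assoc]
  have h₀ : v 0 = u a := by simp [hv]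
  have h₁ : v L = u b := by simp [hv, hL]
  have h₂ : v e = u a := by simp [hv]
  rw [hsum, ← Finset.sum_range_add_sum_Ico _ hLe]
  have h₃ : v 0 - v L ≤ ∑ t ∈ Finset.range L, (v t - v (t + 1)) ^ 2 := by
    rw [← Finset.sum_range_sub']
    exact Finset.sum_le_sum fun t _ => Int.le_self_sq _
  have h₄ : v e - v L ≤ ∑ t ∈ Finset.Ico L e, (v t - v (t + 1)) ^ 2 := by
    rw [← Finset.sum_Ico_sub v hLe]
    refine Finset.sum_le_sum fun t _ => ?_
    rw [← neg_sub (v (t + 1)), neg_sq]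
    exact Int.le_self_sq _
  linarith

lemma IsPartition.antitone {f : ℕ → ℕ} (hf : IsPartition f) : Antitone f :=
  antitone_nat_of_succ_le hf.1

lemma sum_range_eq_rowCount {e : ℕ} {m M : ℕ} (h : m ≤ M) (r : ℕ) (k i : ZMod e) :
    (∑ c ∈ Finset.range M, if c < m ∧ (c : ZMod e) - r + k = i then (1 : ℤ) else 0) =
      rowCount m (k - (r : ZMod e)) i := by
  rw [← Finset.sum_range_add_sum_Ico _ h, rowCount, add_eq_left.2]
  · refine Finset.sum_congr rfl fun c hc => if_congr ?_ rfl rfl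
    rw [← add_sub_assoc, sub_add_eq_add_sub]
    exact and_iff_right (Finset.mem_range.1 hc)
  · exact Finset.sum_eq_zero fun c hc => if_neg fun h => (Finset.mem_Ico.1 hc).1.not_gt h.1

open Classical in
lemma setOf_diagram_res_eq {e : ℕ} (κ : Fin 2 → ZMod e) {lam : Fin 2 → ℕ → ℕ} {M N : ℕ}
    (hM : ∀ a r, lam a r ≤ M) (hN : ∀ a r, N ≤ r → lam a r = 0) (i : ZMod e) :
    {x : Node | x ∈ Diagram lam ∧ res e κ x = i} =
      ↑((Finset.range N ×ˢ (Finset.range M ×ˢ (Finset.univ : Finset (Fin 2)))).filter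
        fun x : Node => x.2.1 < lam x.2.2 x.1 ∧ (x.2.1 : ZMod e) - x.1 + κ x.2.2 = i) := by
  ext ⟨r, c, a⟩
  simp only [Diagram, res, Set.mem_ofPred_eq, Finset.coe_filter, Finset.mem_product,
    Finset.mem_range, Finset.mem_univ, and_true]
  refine ⟨fun h => ⟨⟨?_, h.1.trans_le (hM a r)⟩, h⟩, fun h => h.2⟩
  by_contra hr
  have := hN a r (not_lt.1 hr)
  omega

lemma IsBipartition.exists_bounds {lam : Fin 2 → ℕ → ℕ} (h : IsBipartition lam) :
    ∃ M N, (∀ a r, lam a r ≤ M) ∧ ∀ a r, N ≤ r → lam a r = 0 := by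
  choose N hN using fun a => (h a).2
  refine ⟨lam 0 0 + lam 1 0, N 0 + N 1, fun a r => ?_, fun a r hr => hN a r ?_⟩
  · have := (h a).antitone (Nat.zero_le r)
    fin_cases a <;> simp at this ⊢ <;> omega
  · fin_cases a <;> simp <;> omega

lemma IsBipartition.finite_diagram_res {e : ℕ} (κ : Fin 2 → ZMod e) {lam : Fin 2 → ℕ → ℕ}
    (h : IsBipartition lam) (i : ZMod e) :
    {x : Node | x ∈ Diagram lam ∧ res e κ x = i}.Finite := by
  obtain ⟨M, N, hM, hN⟩ := h.exists_bounds
  rw [setOf_diagram_res_eq κ hM hN]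
  exact Finset.finite_toSet _

lemma IsBipartition.exists_cnt_eq {e : ℕ} (κ : Fin 2 → ZMod e) {lam : Fin 2 → ℕ → ℕ}
    (h : IsBipartition lam) :
    ∃ N, ∀ i, (cnt e κ lam i : ℤ) =
      rowsCount (lam 0) N (κ 0) i + rowsCount (lam 1) N (κ 1) i := by
  classical
  obtain ⟨M, N, hM, hN⟩ := h.exists_bounds
  refine ⟨N, fun i => ?_⟩
  rw [cnt, setOf_diagram_res_eq κ hM hN, Set.ncard_coe_finset, Finset.card_filter]
  push_cast
  simp only [Finset.sum_product, Fin.sum_univ_two, Finset.sum_add_distrib,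
    sum_range_eq_rowCount (hM _ _), rowsCount]

lemma wt_eq {e : ℕ} [NeZero e] (κ : Fin 2 → ZMod e) (lam : Fin 2 → ℕ → ℕ) :
    2 * wt e κ lam = ((2 * (cnt e κ lam (κ 0) + cnt e κ lam (κ 1)) -
      ∑ j, ((cnt e κ lam j : ℤ) - cnt e κ lam (j + 1)) ^ 2 : ℤ) : ℚ) := by
  rw [wt, sum_range_natCast_zmod
    (fun j => ((cnt e κ lam j : ℚ) - (cnt e κ lam (j + 1) : ℚ)) ^ 2)]
  push_cast
  ring

/-- The weight of a bipartition is non-negative. -/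
lemma IsBipartition.wt_nonneg {e : ℕ} [NeZero e] (κ : Fin 2 → ZMod e) {lam : Fin 2 → ℕ → ℕ}
    (h : IsBipartition lam) : 0 ≤ wt e κ lam := by
  suffices H : 0 ≤ 2 * wt e κ lam by linarith
  obtain ⟨N, hc⟩ := h.exists_cnt_eq κ
  rw [wt_eq]
  simp only [hc]
  refine Int.cast_nonneg ?_
  have h₀ := sum_sq_le_two_mul_rowsCount N (lam 0) (h 0).antitone (κ 0)
  have h₁ := sum_sq_le_two_mul_rowsCount N (lam 1) (h 1).antitone (κ 1)
  generalize rowsCount (lam 0) N (κ 0) = p at *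
  generalize rowsCount (lam 1) N (κ 1) = q at *
  have h₂ := two_mul_sub_le_sum_sq (fun j => p j - q j) (κ 0) (κ 1)
  have h₃ : ∑ j, (p j + q j - (p (j + 1) + q (j + 1))) ^ 2 +
      ∑ j, (p j - q j - (p (j + 1) - q (j + 1))) ^ 2 =
      2 * ∑ j, (p j - p (j + 1)) ^ 2 + 2 * ∑ j, (q j - q (j + 1)) ^ 2 := by
    simp only [Finset.mul_sum, ← Finset.sum_add_distrib]
    exact Finset.sum_congr rfl fun j _ => by ring
  linarith

/-- Adding a node to a Young diagram changes the residue content by one. -/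
lemma cnt_eq_add_indicator {e : ℕ} (κ : Fin 2 → ZMod e) {lam mu : Fin 2 → ℕ → ℕ} {x : Node}
    (hlam : IsBipartition lam) (hx : x ∉ Diagram lam) (hmu : Diagram mu = insert x (Diagram lam))
    (j : ZMod e) :
    (cnt e κ mu j : ℤ) = cnt e κ lam j + if res e κ x = j then 1 else 0 := by
  simp only [cnt, hmu]
  split_ifs with h
  · have : {y : Node | y ∈ insert x (Diagram lam) ∧ res e κ y = j} =
        insert x {y : Node | y ∈ Diagram lam ∧ res e κ y = j} := by
      ext y
      simp only [Set.mem_insert_iff, Set.mem_ofPred_eq]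
      grind
    rw [this, Set.ncard_insert_of_notMem (fun hx' => hx hx'.1) (hlam.finite_diagram_res κ j)]
    push_cast
    rfl
  · have : {y : Node | y ∈ insert x (Diagram lam) ∧ res e κ y = j} =
        {y : Node | y ∈ Diagram lam ∧ res e κ y = j} := by
      ext y
      simp only [Set.mem_insert_iff, Set.mem_ofPred_eq]
      grind
    rw [this, add_zero]

/-- The second difference of the weight in the direction of a simple root. -/
lemma wt_add_wt {e : ℕ} [NeZero e] (he : 2 ≤ e) (κ : Fin 2 → ZMod e)
    {lam mu nu : Fin 2 → ℕ → ℕ} {i : ZMod e}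
    (hmu : ∀ j, (cnt e κ mu j : ℤ) = cnt e κ lam j + if i = j then 1 else 0)
    (hnu : ∀ j, (cnt e κ lam j : ℤ) = cnt e κ nu j + if i = j then 1 else 0) :
    wt e κ mu + wt e κ nu = 2 * wt e κ lam - 2 := by
  suffices H : 2 * wt e κ mu + 2 * wt e κ nu = 2 * (2 * wt e κ lam) - 4 by linarith
  have hnu' : ∀ j, (cnt e κ nu j : ℤ) = cnt e κ lam j - if i = j then 1 else 0 :=
    fun j => by rw [hnu j, add_sub_cancel_right]
  obtain ⟨c, hc⟩ : ∃ c : ZMod e → ℤ, ∀ j, (cnt e κ lam j : ℤ) = c j := ⟨_, fun _ => rfl⟩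
  simp only [wt_eq, hmu, hnu', hc]
  have hne : i ≠ i - 1 := by
    have : Fact (1 < e) := ⟨he⟩
    intro h
    exact one_ne_zero (sub_eq_self.1 h.symm)
  have key (d : ZMod e → ℤ) :
      ∑ j, (d j + ((if i = j then 1 else 0) - (if i = j + 1 then 1 else 0))) ^ 2 =
        ∑ j, d j ^ 2 + 2 * d i - 2 * d (i - 1) + 2 := by
    have := sum_sq_add_indicator_sub d i (i - 1)
    simpa [hne, sub_eq_iff_eq_add] using this
  have h₁ := key (fun j => c j - c (j + 1))
  have h₂ := key (fun j => -(c j - c (j + 1)))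
  have h₃ : ∑ j, (c j + (if i = j then 1 else 0) -
        (c (j + 1) + if i = j + 1 then 1 else 0)) ^ 2 =
      ∑ j, (c j - c (j + 1) +
        ((if i = j then 1 else 0) - (if i = j + 1 then 1 else 0))) ^ 2 :=
    Finset.sum_congr rfl fun j _ => by ring
  have h₄ : ∑ j, (c j - (if i = j then 1 else 0) -
        (c (j + 1) - if i = j + 1 then 1 else 0)) ^ 2 =
      ∑ j, (-(c j - c (j + 1)) +
        ((if i = j then 1 else 0) - (if i = j + 1 then 1 else 0))) ^ 2 :=
    Finset.sum_congr rfl fun j _ => by ring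
  simp only [neg_sq] at h₂
  rw [h₃, h₄, h₁, h₂]
  push_cast
  ring

theorem stmt12 (e : ℕ) (he : 2 ≤ e) (κ : Fin 2 → ZMod e) (lam : Fin 2 → ℕ → ℕ)
    (hlam : IsBipartition lam) (hwt : wt e κ lam = 0) (i : ZMod e) :
    ¬ ((∃ x : Node, IsAddable lam x ∧ res e κ x = i) ∧
        (∃ x : Node, IsRemovable lam x ∧ res e κ x = i)) := by
  rintro ⟨⟨x, ⟨hx, mu, hmu, hmux⟩, hxi⟩, ⟨y, ⟨hy, nu, hnu, hnuy⟩, hyi⟩⟩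
  have : NeZero e := ⟨by omega⟩
  have h₁ := cnt_eq_add_indicator κ hlam hx (hmux.trans Set.union_singleton)
  have h₂ := cnt_eq_add_indicator κ (x := y) (mu := lam) hnu (by simp [hnuy])
    (by rw [hnuy, Set.insert_sdiff_singleton, Set.insert_eq_of_mem hy])
  rw [hxi] at h₁
  rw [hyi] at h₂
  have := wt_add_wt he κ h₁ h₂
  have := hmu.wt_nonneg κ
  have := hnu.wt_nonneg κ
  linarith

end Wt3
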